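/- Any two distinct elements of a chain cascade are strongly orthogonal. -/

import Mathlib

open scoped InnerProductSpace BigOperators

structure RootSystemData (V : Type*) [NormedAddCommGroup V] [InnerProductSpace ℝ V] where
  Δ : Set V
  finite : Δ.Finite
  span_top : Submodule.span ℝ Δ = ⊤
  zero_not_mem : (0 : V) ∉ Δ
  neg_mem : ∀ α ∈ Δ, -α ∈ Δ
  reduced : ∀ α ∈ Δ, ∀ t : ℝ, t • α ∈ Δ → t = 1 ∨ t = -1
  crystal : ∀ α ∈ Δ, ∀ β ∈ Δ, ∃ n : ℤ, 2 * ⟪α, β⟫_ℝ = (n : ℝ) * ⟪β, β⟫_ℝ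
  reflect_mem : ∀ α ∈ Δ, ∀ β ∈ Δ, α - (2 * ⟪α, β⟫_ℝ / ⟪β, β⟫_ℝ) • β ∈ Δ
  Pos : Set V
  pos_subset : Pos ⊆ Δ
  mem_or_neg : ∀ α ∈ Δ, α ∈ Pos ∨ -α ∈ Pos
  not_neg_mem : ∀ α ∈ Pos, -α ∉ Pos
  pos_add : ∀ α ∈ Pos, ∀ β ∈ Pos, α + β ∈ Δ → α + β ∈ Pos

namespace RootSystemData

variable {V : Type*} [NormedAddCommGroup V] [InnerProductSpace ℝ V] (R : RootSystemData V)

/-- The set of simple roots: indecomposable positive roots. -/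
def Simple : Set V := {α ∈ R.Pos | ¬ ∃ β ∈ R.Pos, ∃ γ ∈ R.Pos, α = β + γ}

/-- The support `Π(φ)` of a positive root: the simple roots needed to express `φ`. -/
def support (φ : V) : Set V := {α ∈ R.Simple | φ ∉ Submodule.span ℝ (R.Simple \ {α})}

/-- The root subsystem `Δ(φ)`: all roots lying in the span of the support of `φ`. -/
def sub (φ : V) : Set V := {ψ ∈ R.Δ | ψ ∈ Submodule.span ℝ (R.support φ)}

/-- The positive roots `Δ(φ)₊` of the subsystem `Δ(φ)`. -/
def posSub (φ : V) : Set V := R.sub φ ∩ R.Pos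

/-- `x` is a nonnegative integer combination of positive roots. -/
def NonnegComb (x : V) : Prop :=
  ∃ c : V →₀ ℕ, ↑c.support ⊆ R.Pos ∧ x = c.sum fun α n => (n : ℝ) • α

/-- `β` is the highest root of the subset `S`. -/
def IsHighest (S : Set V) (β : V) : Prop :=
  β ∈ S ∧ β ∈ R.Pos ∧ ∀ ψ ∈ S, R.NonnegComb (β - ψ)

/-- `β` is locally high: it is the highest root of `Δ(β)`. -/
def LocallyHigh (β : V) : Prop := β ∈ R.Pos ∧ R.IsHighest (R.sub β) β

/-- `E(β) = {φ ∈ Δ(β) : (φ,β) > 0}`. -/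
def E (β : V) : Set V := {φ ∈ R.sub β | 0 < ⟪φ, β⟫_ℝ}

/-- `Δ(β)° = {φ ∈ Δ(β) : (φ,β) = 0}`. -/
def orth (β : V) : Set V := {φ ∈ R.sub β | ⟪φ, β⟫_ℝ = 0}

/-- Strong orthogonality of two roots. -/
def StronglyOrth (φ ψ : V) : Prop := φ + ψ ∉ R.Δ ∧ φ - ψ ∉ R.Δ


/-- Half the sum of the positive roots of `Δ(β)`. -/
noncomputable def rho (β : V) : V := (2⁻¹ : ℝ) • ∑ᶠ φ ∈ R.posSub β, φ

/-- The dual Coxeter number of `Δ(β)`, `⟨ρ_β, β^∨⟩ + 1`. -/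
noncomputable def dualCoxeter (β : V) : ℝ := 2 * ⟪R.rho β, β⟫_ℝ / ⟪β, β⟫_ℝ + 1

end RootSystemData

/-- A finite set of vectors is irreducible if it is nonempty and admits no splitting into
two nonempty mutually orthogonal pieces. -/
def IsIrred {V : Type*} [NormedAddCommGroup V] [InnerProductSpace ℝ V] (S : Set V) : Prop :=
  S.Nonempty ∧ ¬ ∃ A B : Set V, A ∪ B = S ∧ A ∩ B = ∅ ∧ A.Nonempty ∧ B.Nonempty ∧
    ∀ a ∈ A, ∀ b ∈ B, ⟪a, b⟫_ℝ = 0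

/-- `C` is an irreducible component of `S`. -/
def IsComponent {V : Type*} [NormedAddCommGroup V] [InnerProductSpace ℝ V]
    (S C : Set V) : Prop :=
  C ⊆ S ∧ IsIrred C ∧ ∀ a ∈ C, ∀ b ∈ S \ C, ⟪a, b⟫_ℝ = 0

/-- The reflection `s_β` in the (co)vector `β`. -/
noncomputable def reflectRoot {V : Type*} [NormedAddCommGroup V] [InnerProductSpace ℝ V]
    (β v : V) : V := v - (2 * ⟪v, β⟫_ℝ / ⟪β, β⟫_ℝ) • β

namespace RootSystemData

variable {V : Type*} [NormedAddCommGroup V] [InnerProductSpace ℝ V] (R : RootSystemData V)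

/-- A chain cascade: a nonempty list whose head is the highest root of an irreducible
component of `Δ`, and each subsequent entry is the highest root of an irreducible component
of `Δ(previous)°`. -/
def IsChainCascade (l : List V) : Prop :=
  l ≠ [] ∧
  (∀ b ∈ l.head?, ∃ C, IsComponent R.Δ C ∧ R.IsHighest C b) ∧
  l.Chain' fun γ δ => ∃ C, IsComponent (R.orth γ) C ∧ R.IsHighest C δ

/-- The cascade `ℬ` of roots: all positive roots belonging to some chain cascade. -/
def cascade : Set V := {β | ∃ l, R.IsChainCascade l ∧ β ∈ l}

/-- `l` is the chain cascade `C(φ)` associated to the positive root `φ`. -/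
def IsCascadeChainOf (φ : V) (l : List V) : Prop :=
  R.IsChainCascade l ∧ (∀ β ∈ l, φ ∈ R.sub β) ∧
  (∀ β ∈ l.dropLast, ⟪φ, β⟫_ℝ = 0) ∧ ∀ β ∈ l.getLast?, 0 < ⟪φ, β⟫_ℝ

end RootSystemData

namespace RootSystemData

variable {V : Type*} [NormedAddCommGroup V] [InnerProductSpace ℝ V] (R : RootSystemData V)

theorem ne_zero_of_mem {α : V} (hα : α ∈ R.Δ) : α ≠ 0 :=
  fun h => R.zero_not_mem (h ▸ hα)

theorem inner_self_pos_of_mem {α : V} (hα : α ∈ R.Δ) : 0 < ⟪α, α⟫_ℝ :=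
  real_inner_self_pos.2 (R.ne_zero_of_mem hα)

theorem add_mem_of_inner_neg {α β : V} (hα : α ∈ R.Δ) (hβ : β ∈ R.Δ)
    (h : ⟪α, β⟫_ℝ < 0) (hne : α + β ≠ 0) : α + β ∈ R.Δ := by
  -- a pairing equal to `-1` means that the reflection is the sum
  have key : ∀ {x y : V}, x ∈ R.Δ → y ∈ R.Δ → ⟪x, y⟫_ℝ < 0 →
      x + y ∈ R.Δ ∨ 2 * ⟪x, y⟫_ℝ ≤ -2 * ⟪y, y⟫_ℝ := by
    intro x y hx hy hxy
    obtain ⟨n, hn⟩ := R.crystal x hx y hy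
    have hpos := R.inner_self_pos_of_mem hy
    have hn0 : n < 0 := by
      by_contra! hn0
      have : (0 : ℝ) ≤ n := by exact_mod_cast hn0
      nlinarith
    rcases (show n = -1 ∨ n ≤ -2 by omega) with rfl | hn2
    · left
      have := R.reflect_mem x hx y hy
      rw [hn, mul_div_cancel_right₀ _ hpos.ne'] at this
      simpa using this
    · right
      have : (n : ℝ) ≤ -2 := by exact_mod_cast hn2
      nlinarith
  rcases key hα hβ h with h1 | h1
  · exact h1
  rcases key hβ hα (by rwa [real_inner_comm]) with h2 | h2
  · rwa [add_comm]
  refine absurd ?_ hne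
  rw [← real_inner_self_nonpos, inner_add_left, inner_add_right, inner_add_right]
  rw [real_inner_comm] at h2
  linarith [real_inner_comm α β]

theorem multiset_sum_ne_zero (s : Multiset V) (hs : ∀ a ∈ s, a ∈ R.Pos) (h0 : s ≠ 0) :
    s.sum ≠ 0 := by
  classical
  induction hn : Multiset.card s using Nat.strong_induction_on generalizing s with
  | _ n ih =>
  intro hsum
  obtain ⟨a, ha⟩ := Multiset.exists_mem_of_ne_zero h0
  obtain ⟨t, rfl⟩ := Multiset.exists_cons_of_mem ha
  have haP : a ∈ R.Pos := hs a ha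
  have hpos := R.inner_self_pos_of_mem (R.pos_subset haP)
  have hex : ∃ b ∈ t, ⟪a, b⟫_ℝ < 0 := by
    by_contra! hcon
    have h1 : 0 ≤ (t.map fun b => ⟪a, b⟫_ℝ).sum :=
      Multiset.sum_nonneg fun x hx => by
        obtain ⟨b, hb, rfl⟩ := Multiset.mem_map.1 hx
        exact hcon b hb
    have h2 : (t.map fun b => ⟪a, b⟫_ℝ).sum = ⟪a, t.sum⟫_ℝ := by
      simpa using ((innerₛₗ ℝ a).toAddMonoidHom.map_multiset_sum t).symm
    have h3 : ⟪a, a + t.sum⟫_ℝ = 0 := by rw [← Multiset.sum_cons, hsum, inner_zero_right]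
    rw [inner_add_right] at h3
    linarith
  obtain ⟨b, hb, hab⟩ := hex
  obtain ⟨u, rfl⟩ := Multiset.exists_cons_of_mem hb
  have hbP : b ∈ R.Pos := hs b (by simp)
  have hmem : a + b ∈ R.Pos := by
    refine R.pos_add a haP b hbP
      (R.add_mem_of_inner_neg (R.pos_subset haP) (R.pos_subset hbP) hab fun h => ?_)
    exact R.not_neg_mem a haP ((neg_eq_of_add_eq_zero_right h) ▸ hbP)
  refine ih (Multiset.card ((a + b) ::ₘ u)) (by simp [← hn]) ((a + b) ::ₘ u) ?_ (by simp) rfl ?_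
  · intro x hx
    rcases Multiset.mem_cons.1 hx with rfl | hx
    · exact hmem
    · exact hs x (by simp [hx])
  · simpa [add_assoc] using hsum

theorem neg_notMem_closure {α : V} (hα : α ∈ R.Pos) :
    -α ∉ AddSubmonoid.closure R.Pos := by
  intro h
  obtain ⟨s, hs, hsum⟩ := AddSubmonoid.exists_multiset_of_mem_closure h
  refine R.multiset_sum_ne_zero (α ::ₘ s) ?_ (by simp) (by simp [hsum])
  intro a ha
  rcases Multiset.mem_cons.1 ha with rfl | ha
  exacts [hα, hs a ha]

theorem mem_closure_of_nonnegComb {x : V} (hx : R.NonnegComb x) :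
    x ∈ AddSubmonoid.closure R.Pos := by
  obtain ⟨c, hc, rfl⟩ := hx
  refine sum_mem fun a ha => ?_
  simp only [Nat.cast_smul_eq_nsmul]
  exact nsmul_mem (AddSubmonoid.subset_closure (hc ha)) _

theorem eq_zero_of_sum_eq_zero {ι : Type*} (s : Finset ι) (f : ι → V) (n : ι → ℕ)
    (hf : ∀ i ∈ s, f i ∈ R.Pos) (h : ∑ i ∈ s, (n i : ℝ) • f i = 0) : ∀ i ∈ s, n i = 0 := by
  classical
  intro i hi
  by_contra hni
  obtain ⟨m, hm⟩ := Nat.exists_eq_succ_of_ne_zero hni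
  have hmem : ∀ j ∈ s, f j ∈ AddSubmonoid.closure R.Pos := fun j hj =>
    AddSubmonoid.subset_closure (hf j hj)
  refine R.neg_notMem_closure (hf i hi) ?_
  simp only [Nat.cast_smul_eq_nsmul] at h
  rw [← Finset.add_sum_erase s _ hi, hm, succ_nsmul', add_assoc] at h
  rw [neg_eq_of_add_eq_zero_right h]
  exact add_mem (nsmul_mem (hmem i hi) _)
    (sum_mem fun j hj => nsmul_mem (hmem j (Finset.mem_of_mem_erase hj)) _)

theorem pos_subset_closure_simple {α : V} (hα : α ∈ R.Pos) :
    α ∈ AddSubmonoid.closure R.Simple := by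
  have hfin : ∀ x, {γ ∈ R.Pos | x - γ ∈ AddSubmonoid.closure R.Pos}.Finite := fun x =>
    R.finite.subset fun γ hγ => R.pos_subset hγ.1
  induction hn : {γ ∈ R.Pos | α - γ ∈ AddSubmonoid.closure R.Pos}.ncard
    using Nat.strong_induction_on generalizing α with
  | _ n ih =>
  by_cases hs : α ∈ R.Simple
  · exact AddSubmonoid.subset_closure hs
  have hdec : ∃ β ∈ R.Pos, ∃ γ ∈ R.Pos, α = β + γ := by
    by_contra hcon
    exact hs ⟨hα, hcon⟩
  have hlt : ∀ β ∈ R.Pos, ∀ γ ∈ R.Pos, α = β + γ → β ∈ AddSubmonoid.closure R.Simple := by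
    intro β hβ γ hγ h
    refine ih _ ?_ hβ rfl
    rw [← hn]
    refine Set.ncard_lt_ncard ⟨fun δ hδ => ⟨hδ.1, ?_⟩, fun hsub => ?_⟩ (hfin α)
    · rw [h, add_sub_right_comm]
      exact add_mem hδ.2 (AddSubmonoid.subset_closure hγ)
    · have := (hsub (show α ∈ _ from ⟨hα, by simp⟩)).2
      rw [h, sub_add_cancel_left] at this
      exact R.neg_notMem_closure hγ this
  obtain ⟨β, hβ, γ, hγ, h⟩ := hdec
  rw [h]
  exact add_mem (hlt β hβ γ hγ h) (hlt γ hγ β hβ (by rw [h, add_comm]))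

theorem inner_simple_nonpos {α β : V} (hα : α ∈ R.Simple) (hβ : β ∈ R.Simple) (hne : α ≠ β) :
    ⟪α, β⟫_ℝ ≤ 0 := by
  by_contra! h
  have hmem : α - β ∈ R.Δ := by
    rw [sub_eq_add_neg]
    refine R.add_mem_of_inner_neg (R.pos_subset hα.1) (R.neg_mem _ (R.pos_subset hβ.1)) ?_ ?_
    · rw [inner_neg_right]; linarith
    · rwa [← sub_eq_add_neg, sub_ne_zero]
  rcases R.mem_or_neg _ hmem with h1 | h1
  · exact hα.2 ⟨α - β, h1, β, hβ.1, by simp⟩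
  · exact hβ.2 ⟨-(α - β), h1, α, hα.1, by simp⟩

theorem int_relation_eq_zero {ι : Type*} [Fintype ι] (f : ι → V) (hf : ∀ i, f i ∈ R.Simple)
    (hinj : Function.Injective f) (v : ι → ℤ) (h : ∑ i, (v i : ℝ) • f i = 0) : v = 0 := by
  have hsplit : ∀ i, (v i : ℝ) = ((v i).toNat : ℝ) - ((-v i).toNat : ℝ) := fun i => by
    have : v i = ((v i).toNat : ℤ) - ((-v i).toNat : ℤ) := by omega
    exact_mod_cast congrArg (Int.cast : ℤ → ℝ) this
  have heq : ∑ i, ((v i).toNat : ℝ) • f i = ∑ i, ((-v i).toNat : ℝ) • f i := by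
    rw [← sub_eq_zero, ← Finset.sum_sub_distrib, ← h]
    exact Finset.sum_congr rfl fun i _ => by rw [hsplit i, sub_smul]
  have hzero : ∑ i, ((v i).toNat : ℝ) • f i = 0 := by
    rw [← real_inner_self_nonpos]
    nth_rw 2 [heq]
    simp only [sum_inner, inner_sum, real_inner_smul_left, real_inner_smul_right]
    refine Finset.sum_nonpos fun i _ => Finset.sum_nonpos fun j _ => ?_
    by_cases hij : i = j
    · subst hij
      rcases le_total (v i) 0 with hv | hv
      · simp [Int.toNat_of_nonpos hv]
      · simp [Int.toNat_of_nonpos (neg_nonpos.2 hv)]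
    · have := R.inner_simple_nonpos (hf j) (hf i) (hinj.ne (Ne.symm hij))
      exact mul_nonpos_of_nonneg_of_nonpos (by positivity)
        (mul_nonpos_of_nonneg_of_nonpos (by positivity) this)
  have h1 := R.eq_zero_of_sum_eq_zero _ f _ (fun i _ => (hf i).1) hzero
  have h2 := R.eq_zero_of_sum_eq_zero _ f _ (fun i _ => (hf i).1) (heq ▸ hzero)
  funext i
  have := h1 i (Finset.mem_univ i)
  have := h2 i (Finset.mem_univ i)
  simp only [Pi.zero_apply]
  omega

theorem linearIndepOn_simple : LinearIndepOn ℝ id R.Simple := by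
  classical
  have : Fintype R.Simple := (R.finite.subset fun α hα => R.pos_subset hα.1).fintype
  choose M hM using fun i j : R.Simple =>
    R.crystal j (R.pos_subset j.2.1) i (R.pos_subset i.2.1)
  -- pairing a combination of simple roots with a simple root is the Cartan matrix action
  have hpair : ∀ (c : R.Simple → ℝ) (i : R.Simple),
      2 * ⟪∑ j, c j • (j : V), i⟫_ℝ = (∑ j, (M i j : ℝ) * c j) * ⟪(i : V), i⟫_ℝ := by
    intro c i
    rw [sum_inner, Finset.mul_sum, Finset.sum_mul]
    refine Finset.sum_congr rfl fun j _ => ?_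
    rw [real_inner_smul_left]
    linear_combination c j * hM i j
  have hdet : (Matrix.of M).det ≠ 0 := by
    intro hdet
    obtain ⟨v, hv0, hv⟩ := Matrix.exists_mulVec_eq_zero_iff.2 hdet
    refine hv0 (R.int_relation_eq_zero (fun i : R.Simple => (i : V)) (fun i => i.2)
      Subtype.val_injective v ?_)
    have horth : ∀ i : R.Simple, ⟪∑ j, (v j : ℝ) • (j : V), i⟫_ℝ = 0 := by
      intro i
      have h1 : ∑ j, (M i j : ℝ) * (v j : ℝ) = 0 := by
        have := congrFun hv i
        simp only [Matrix.mulVec, dotProduct, Matrix.of_apply, Pi.zero_apply] at this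
        exact_mod_cast this
      have h2 := hpair (fun j => v j) i
      rw [h1, zero_mul] at h2
      linarith
    rw [← inner_self_eq_zero (𝕜 := ℝ), inner_sum]
    exact Finset.sum_eq_zero fun i _ => by rw [real_inner_smul_right, horth, mul_zero]
  show LinearIndependent ℝ fun i : R.Simple => (i : V)
  rw [Fintype.linearIndependent_iff]
  intro c hc
  have hdetR : ((Matrix.of M).map (Int.castRingHom ℝ)).det ≠ 0 := by
    rw [← RingHom.mapMatrix_apply, ← RingHom.map_det]
    simpa using hdet
  refine congrFun (Matrix.eq_zero_of_mulVec_eq_zero hdetR ?_)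
  funext i
  have h := hpair c i
  rw [hc, inner_zero_left, mul_zero] at h
  have := (mul_eq_zero.1 h.symm).resolve_right (R.inner_self_pos_of_mem (R.pos_subset i.2.1)).ne'
  simpa [Matrix.mulVec, dotProduct] using this

theorem exists_support_expansion {β : V} (hβ : β ∈ R.Pos) :
    ∃ (s : Finset V) (n : V → ℕ), ↑s = R.support β ∧ (∀ α ∈ s, n α ≠ 0) ∧
      ∑ α ∈ s, (n α : ℝ) • α = β := by
  classical
  obtain ⟨m, hm, rfl⟩ :=
    AddSubmonoid.exists_multiset_of_mem_closure (R.pos_subset_closure_simple hβ)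
  have hsum : m.sum = ∑ α ∈ m.toFinset, (m.count α : ℝ) • α := by
    simp [Finset.sum_multiset_count, Nat.cast_smul_eq_nsmul]
  refine ⟨m.toFinset, m.count, ?_, fun α hα => by simpa using hα, hsum.symm⟩
  ext α
  simp only [Finset.mem_coe, Multiset.mem_toFinset]
  constructor
  · refine fun hα => ⟨hm α hα, fun hspan => ?_⟩
    have hα' : α ∈ m.toFinset := by simpa using hα
    rw [hsum, ← Finset.add_sum_erase _ _ hα'] at hspan
    have hrest : ∑ γ ∈ m.toFinset.erase α, (m.count γ : ℝ) • γ ∈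
        Submodule.span ℝ (R.Simple \ {α}) := sum_mem fun γ hγ => by
      rw [Finset.mem_erase, Multiset.mem_toFinset] at hγ
      exact Submodule.smul_mem _ _ (Submodule.subset_span ⟨hm γ hγ.2, hγ.1⟩)
    have hmul := (Submodule.add_mem_iff_left _ hrest).1 hspan
    have hcount : (m.count α : ℝ) ≠ 0 := by simpa using hα
    refine R.linearIndepOn_simple.notMem_span (hm α hα) ?_
    rw [Set.image_id]
    exact (Submodule.smul_mem_iff _ hcount).1 hmul
  · rintro ⟨hα, hspan⟩
    by_contra hnot
    refine hspan (Submodule.span ℝ _ |>.toAddSubmonoid.multiset_sum_mem m fun γ hγ => ?_)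
    exact Submodule.subset_span ⟨hm γ hγ, fun h => hnot (h ▸ hγ)⟩

theorem support_subset_pos (β : V) : R.support β ⊆ R.Pos := fun _ h => h.1.1

theorem support_subset_sub (β : V) : R.support β ⊆ R.sub β := fun _ h =>
  ⟨R.pos_subset (R.support_subset_pos β h), Submodule.subset_span h⟩

theorem mem_span_support {β : V} (hβ : β ∈ R.Pos) : β ∈ Submodule.span ℝ (R.support β) := by
  obtain ⟨s, n, hs, -, hsum⟩ := R.exists_support_expansion hβ
  have : ∑ α ∈ s, (n α : ℝ) • α ∈ Submodule.span ℝ (R.support β) :=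
    sum_mem fun α hα => Submodule.smul_mem _ _
      (Submodule.subset_span (by rwa [← hs, Finset.mem_coe]))
  rwa [hsum] at this

theorem support_subset_of_mem_span {β γ : V} (h : γ ∈ Submodule.span ℝ (R.support β)) :
    R.support γ ⊆ R.support β := by
  intro α hα
  by_contra hnot
  exact hα.2 (Submodule.span_mono (t := R.Simple \ {α})
    (fun δ hδ => ⟨hδ.1, fun hδα => hnot ((show δ = α from hδα) ▸ hδ)⟩) h)

theorem inner_eq_zero_of_mem_span {S : Set V} {x y : V} (hS : ∀ α ∈ S, ⟪α, y⟫_ℝ = 0)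
    (hx : x ∈ Submodule.span ℝ S) : ⟪x, y⟫_ℝ = 0 := by
  induction hx using Submodule.span_induction with
  | mem a ha => exact hS a ha
  | zero => exact inner_zero_left _
  | add a b _ _ ha hb => rw [inner_add_left, ha, hb, add_zero]
  | smul t a _ ha => rw [real_inner_smul_left, ha, mul_zero]

theorem LocallyHigh.add_notMem {R : RootSystemData V} {β γ : V} (hβ : R.LocallyHigh β)
    (hγ : γ ∈ R.Pos) (hsub : γ ∈ R.sub β) : β + γ ∉ R.Δ := by
  intro h
  have := R.mem_closure_of_nonnegComb
    (hβ.2.2.2 (β + γ) ⟨h, add_mem (R.mem_span_support hβ.1) hsub.2⟩)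
  rw [sub_add_cancel_left] at this
  exact R.neg_notMem_closure hγ this

theorem LocallyHigh.inner_support_nonneg {R : RootSystemData V} {β α : V}
    (hβ : R.LocallyHigh β) (hα : α ∈ R.support β) : 0 ≤ ⟪α, β⟫_ℝ := by
  by_contra! h
  have hαP := R.support_subset_pos β hα
  refine hβ.add_notMem hαP (R.support_subset_sub β hα)
    (R.add_mem_of_inner_neg (R.pos_subset hβ.1) (R.pos_subset hαP)
      (by rwa [real_inner_comm]) fun h0 => ?_)
  exact R.not_neg_mem β hβ.1 ((neg_eq_of_add_eq_zero_right h0) ▸ hαP)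

/-- The support of a positive root of `Δ(β)°` is orthogonal to the locally high root `β`. -/
theorem LocallyHigh.inner_support_eq_zero {R : RootSystemData V} {β γ : V}
    (hβ : R.LocallyHigh β) (hγ : γ ∈ R.Pos) (horth : γ ∈ R.orth β) :
    ∀ α ∈ R.support γ, ⟪α, β⟫_ℝ = 0 := by
  obtain ⟨s, n, hs, hn, hsum⟩ := R.exists_support_expansion hγ
  have h0 : ∑ α ∈ s, (n α : ℝ) * ⟪α, β⟫_ℝ = 0 := by
    simp_rw [← real_inner_smul_left]
    rw [← sum_inner, hsum]
    exact horth.2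
  intro α hα
  rw [← hs] at hα
  have hterm := (Finset.sum_eq_zero_iff_of_nonneg fun δ hδ =>
    mul_nonneg (Nat.cast_nonneg (n δ)) (hβ.inner_support_nonneg
      (R.support_subset_of_mem_span horth.1.2 (hs ▸ hδ)))).1 h0 α hα
  exact (mul_eq_zero.1 hterm).resolve_left (Nat.cast_ne_zero.2 (hn α hα))

/-- The highest root of a component of `S` is locally high if `Δ(β) ⊆ S`. -/
theorem locallyHigh_of_isHighest {S C : Set V} {β : V} (hC : IsComponent S C)
    (hβ : R.IsHighest C β) (hS : R.sub β ⊆ S) : R.LocallyHigh β := by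
  classical
  have hβP := hβ.2.1
  have hsupp : R.support β ⊆ C := by
    obtain ⟨s, n, hs, hn, hsum⟩ := R.exists_support_expansion hβP
    set y := ∑ α ∈ s with α ∉ C, (n α : ℝ) • α with hy
    have hyC : ∀ c ∈ C, ⟪y, c⟫_ℝ = 0 := fun c hc => by
      rw [hy, sum_inner]
      refine Finset.sum_eq_zero fun α hα => ?_
      rw [Finset.mem_filter] at hα
      rw [real_inner_smul_left, real_inner_comm,
        hC.2.2 c hc α ⟨hS (R.support_subset_sub β (hs ▸ hα.1)), hα.2⟩, mul_zero]
    have hyy : ⟪y, y⟫_ℝ = 0 := by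
      have hdec : y = β - ∑ α ∈ s with α ∈ C, (n α : ℝ) • α := by
        rw [← hsum, ← Finset.sum_filter_add_sum_filter_not s (· ∈ C), add_sub_cancel_left]
      nth_rw 2 [hdec]
      rw [inner_sub_right, hyC β hβ.1, inner_sum, zero_sub, neg_eq_zero]
      refine Finset.sum_eq_zero fun α hα => ?_
      rw [real_inner_smul_right, hyC α (Finset.mem_filter.1 hα).2, mul_zero]
    have hn0 := R.eq_zero_of_sum_eq_zero _ _ n
      (fun α hα => R.support_subset_pos β (hs ▸ (Finset.mem_filter.1 hα).1))
      (inner_self_eq_zero.1 hyy)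
    intro α hα
    rw [← hs] at hα
    by_contra hαC
    exact hn α hα (hn0 α (Finset.mem_filter.2 ⟨hα, hαC⟩))
  have hsub : R.sub β ⊆ C := by
    intro ψ hψ
    by_contra hψC
    refine R.ne_zero_of_mem hψ.1 (inner_self_eq_zero (𝕜 := ℝ).1 ?_)
    exact inner_eq_zero_of_mem_span
      (fun α hα => hC.2.2 α (hsupp hα) ψ ⟨hS hψ, hψC⟩) hψ.2
  exact ⟨hβP, ⟨R.pos_subset hβP, R.mem_span_support hβP⟩, hβP, fun ψ hψ => hβ.2.2 ψ (hsub hψ)⟩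

/-- The relation between an earlier root `γ` and a later root `δ` of a chain cascade. -/
def Precedes (γ δ : V) : Prop :=
  R.LocallyHigh γ ∧ δ ∈ R.Pos ∧ R.support δ ⊆ R.support γ ∧ ∀ α ∈ R.support δ, ⟪α, γ⟫_ℝ = 0

instance : IsTrans V R.Precedes where
  trans _ _ _ h₁ h₂ :=
    ⟨h₁.1, h₂.2.1, h₂.2.2.1.trans h₁.2.2.1, fun α hα => h₁.2.2.2 α (h₂.2.2.1 hα)⟩

theorem Precedes.stronglyOrth {R : RootSystemData V} {γ δ : V} (h : R.Precedes γ δ) :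
    R.StronglyOrth γ δ := by
  obtain ⟨hγ, hδ, hsub, horth⟩ := h
  have hspan := R.mem_span_support hδ
  have h0 : ⟪δ, γ⟫_ℝ = 0 := inner_eq_zero_of_mem_span horth hspan
  have hadd := hγ.add_notMem hδ ⟨R.pos_subset hδ, Submodule.span_mono hsub hspan⟩
  refine ⟨hadd, fun hdiff => hadd ?_⟩
  have hpos := R.inner_self_pos_of_mem (R.pos_subset hδ)
  have := R.reflect_mem _ hdiff δ (R.pos_subset hδ)
  rw [inner_sub_left, real_inner_comm, h0, zero_sub, mul_neg, neg_div,
    mul_div_cancel_right₀ _ hpos.ne'] at this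
  convert this using 1
  module

theorem precedes_of_isHighest {γ δ : V} (hγ : R.LocallyHigh γ) {C : Set V}
    (hC : IsComponent (R.orth γ) C) (hδ : R.IsHighest C δ) :
    R.Precedes γ δ ∧ R.LocallyHigh δ := by
  have horth : δ ∈ R.orth γ := hC.1 hδ.1
  have hsub := R.support_subset_of_mem_span horth.1.2
  have h0 := hγ.inner_support_eq_zero hδ.2.1 horth
  exact ⟨⟨hγ, hδ.2.1, hsub, h0⟩, R.locallyHigh_of_isHighest hC hδ fun ψ hψ =>
    ⟨⟨hψ.1, Submodule.span_mono hsub hψ.2⟩, inner_eq_zero_of_mem_span h0 hψ.2⟩⟩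

theorem isChain_precedes {l : List V}
    (hl : l.IsChain fun γ δ => ∃ C, IsComponent (R.orth γ) C ∧ R.IsHighest C δ)
    (hhead : ∀ b ∈ l.head?, R.LocallyHigh b) : l.IsChain R.Precedes := by
  induction hl with
  | nil => exact .nil
  | singleton a => exact .singleton a
  | cons_cons h _ ih =>
    obtain ⟨C, hC, hδ⟩ := h
    have := R.precedes_of_isHighest (hhead _ (by simp)) hC hδ
    exact .cons_cons this.1 (ih (by simpa using this.2))

theorem StronglyOrth.symm {R : RootSystemData V} {φ ψ : V} (h : R.StronglyOrth φ ψ) :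
    R.StronglyOrth ψ φ :=
  ⟨add_comm φ ψ ▸ h.1, fun hm => h.2 (neg_sub ψ φ ▸ R.neg_mem _ hm)⟩

end RootSystemData

/-- Any two distinct elements of a chain cascade are strongly orthogonal. -/
theorem statement4 {V : Type*} [NormedAddCommGroup V] [InnerProductSpace ℝ V]
    (R : RootSystemData V) (l : List V) (hl : R.IsChainCascade l) :
    ∀ β ∈ l, ∀ β' ∈ l, β ≠ β' → R.StronglyOrth β β' := by
  have hchain := R.isChain_precedes hl.2.2 fun b hb => by
    obtain ⟨C, hC, hb'⟩ := hl.2.1 b hb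
    exact R.locallyHigh_of_isHighest hC hb' fun ψ hψ => hψ.1
  have hpair : l.Pairwise R.StronglyOrth :=
    (List.isChain_iff_pairwise.1 hchain).imp fun h => h.stronglyOrth
  have : Std.Symm R.StronglyOrth := ⟨fun _ _ h => h.symm⟩
  exact fun β hβ β' hβ' hne => hpair.forall hβ hβ' hne
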